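/- arXiv:2401.03211 — 2 statements merged into one kernel-verified Lean document; each statement's English description precedes it below -/
import Mathlib

section
/- Let X be a uniformly convex real Banach space and let q be a real number with 1 < q < ∞. Then the sequence space ℓ^q(X) (the space of sequences (x_ν)_{ν∈ℕ} in X with Σ_ν ‖x_ν‖^q < ∞, equipped with the norm ‖(x_ν)‖ = (Σ_ν ‖x_ν‖^q)^{1/q}) is uniformly convex. -/
open Set
open scoped ENNReal

lemma half_add_rpow_lt {q t : ℝ} (hq : 1 < q) (ht : 0 ≤ t) (ht1 : t ≠ 1) :
    ((1 + t) / 2) ^ q < (1 + t ^ q) / 2 := by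
  have h := (strictConvexOn_rpow hq).2 (mem_Ici.2 zero_le_one) (mem_Ici.2 ht) ht1.symm
    (by norm_num : (0 : ℝ) < 1 / 2) (by norm_num : (0 : ℝ) < 1 / 2) (by norm_num)
  simp only [smul_eq_mul, Real.one_rpow] at h
  rw [show 1 / 2 * 1 + 1 / 2 * t = (1 + t) / 2 by ring] at h
  linarith

lemma half_add_rpow_le {q a b : ℝ} (hq : 1 ≤ q) (ha : 0 ≤ a) (hb : 0 ≤ b) :
    ((a + b) / 2) ^ q ≤ (a ^ q + b ^ q) / 2 := by
  have h := (convexOn_rpow hq).2 (mem_Ici.2 ha) (mem_Ici.2 hb)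
    (by norm_num : (0 : ℝ) ≤ 1 / 2) (by norm_num : (0 : ℝ) ≤ 1 / 2) (by norm_num)
  simp only [smul_eq_mul] at h
  rw [show 1 / 2 * a + 1 / 2 * b = (a + b) / 2 by ring] at h
  linarith

section UniformConvex

variable (E : Type*) [NormedAddCommGroup E] [NormedSpace ℝ E] [UniformConvexSpace E]

/-- In a uniformly convex space, the midpoint inequality for `‖·‖ ^ q` improves by a fixed amount
on pairs of separated vectors with larger norm `1`. -/
lemma exists_norm_half_add_rpow_add_le {q ε : ℝ} (hq : 1 < q) (hε : 0 < ε) :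
    ∃ m, 0 < m ∧ ∀ x y : E, ‖x‖ = 1 → ‖y‖ ≤ 1 → ε ≤ ‖x - y‖ →
      (‖x + y‖ / 2) ^ q + m ≤ (‖x‖ ^ q + ‖y‖ ^ q) / 2 := by
  obtain ⟨δ, hδ, h⟩ := exists_forall_closed_ball_dist_add_le_two_sub E hε
  have hq0 : 0 ≤ q := by linarith
  let K : Set (ℝ × ℝ) := (Icc 0 1 ×ˢ Icc 0 1) ∩ ({z | z.1 ≤ (1 + z.2) / 2} ∩ {z | z.1 ≤ 1 - δ / 2})
  have hK : IsCompact K := (isCompact_Icc.prod isCompact_Icc).inter_right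
    ((isClosed_le (by fun_prop) (by fun_prop)).inter (isClosed_le (by fun_prop) (by fun_prop)))
  have hcont : Continuous fun z : ℝ × ℝ => (1 + z.2 ^ q) / 2 - z.1 ^ q :=
    ((continuous_const.add (continuous_snd.rpow_const fun _ => .inr hq0)).div_const 2).sub
      (continuous_fst.rpow_const fun _ => .inr hq0)
  obtain ⟨m, hm, hmK⟩ := hK.exists_forall_le' (a := 0) hcont.continuousOn (by
    rintro ⟨s, t⟩ ⟨⟨⟨hs0, -⟩, ht0, -⟩, hst, hsδ⟩
    rw [mem_ofPred_eq] at hst hsδ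
    dsimp only at *
    rw [sub_pos]
    rcases eq_or_ne t 1 with rfl | ht1
    · have := Real.rpow_lt_one hs0 (by linarith) (by linarith : 0 < q)
      simpa using this
    · exact (Real.rpow_le_rpow hs0 hst hq0).trans_lt (half_add_rpow_lt hq ht0 ht1))
  refine ⟨m, hm, fun x y hx hy hxy => ?_⟩
  have h1 := h hx.le hy hxy
  have h2 := norm_add_le x y
  have h3 := hmK (‖x + y‖ / 2, ‖y‖) ⟨⟨⟨by positivity, by linarith⟩, norm_nonneg _, hy⟩,
    by rw [mem_ofPred_eq]; linarith, by rw [mem_ofPred_eq]; linarith⟩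
  dsimp only at h3
  rw [hx, Real.one_rpow]
  linarith

/-- A homogeneous form of uniform convexity: up to an arbitrarily small relative error `η`, the
midpoint inequality for `‖·‖ ^ q` improves by a multiple of `‖x - y‖ ^ q`. -/
lemma exists_norm_half_add_rpow_add_mul_norm_sub_rpow_le {q η : ℝ} (hq : 1 < q) (hη : 0 < η) :
    ∃ c, 0 < c ∧ ∀ x y : E,
      (‖x + y‖ / 2) ^ q + c * ‖x - y‖ ^ q ≤ (1 / 2 + c * η) * (‖x‖ ^ q + ‖y‖ ^ q) := by
  have hq0 : 0 < q := by linarith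
  obtain ⟨m, hm, h⟩ := exists_norm_half_add_rpow_add_le E hq (Real.rpow_pos_of_pos hη q⁻¹)
  have hc : 0 < m / 2 ^ q := by positivity
  have unit (x y : E) (hx : ‖x‖ = 1) (hy : ‖y‖ ≤ 1) :
      (‖x + y‖ / 2) ^ q + m / 2 ^ q * ‖x - y‖ ^ q
        ≤ (1 / 2 + m / 2 ^ q * η) * (‖x‖ ^ q + ‖y‖ ^ q) := by
    have hyq : 0 ≤ ‖y‖ ^ q := by positivity
    have hxq : ‖x‖ ^ q = 1 := by rw [hx, Real.one_rpow]
    rcases le_total (η ^ q⁻¹) ‖x - y‖ with hxy | hxy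
    · have h1 := h x y hx hy hxy
      have h2 : ‖x - y‖ ^ q ≤ 2 ^ q :=
        Real.rpow_le_rpow (norm_nonneg _) (by linarith [norm_sub_le x y]) hq0.le
      have h3 : m / 2 ^ q * ‖x - y‖ ^ q ≤ m := by
        calc m / 2 ^ q * ‖x - y‖ ^ q ≤ m / 2 ^ q * 2 ^ q := by gcongr
          _ = m := div_mul_cancel₀ _ (by positivity)
      have h4 : 0 ≤ m / 2 ^ q * η * (‖x‖ ^ q + ‖y‖ ^ q) := by positivity
      linarith
    · have h1 : ‖x - y‖ ^ q ≤ η := by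
        have := Real.rpow_le_rpow (norm_nonneg _) hxy hq0.le
        rwa [Real.rpow_inv_rpow hη.le hq0.ne'] at this
      have h2 : (‖x + y‖ / 2) ^ q ≤ (‖x‖ ^ q + ‖y‖ ^ q) / 2 :=
        (Real.rpow_le_rpow (by positivity) (by linarith [norm_add_le x y]) hq0.le).trans
          (half_add_rpow_le hq.le (norm_nonneg x) (norm_nonneg y))
      have h3 : m / 2 ^ q * ‖x - y‖ ^ q ≤ m / 2 ^ q * (η * (‖x‖ ^ q + ‖y‖ ^ q)) := by
        gcongr
        nlinarith
      linarith
  have ordered (x y : E) (hyx : ‖y‖ ≤ ‖x‖) :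
      (‖x + y‖ / 2) ^ q + m / 2 ^ q * ‖x - y‖ ^ q
        ≤ (1 / 2 + m / 2 ^ q * η) * (‖x‖ ^ q + ‖y‖ ^ q) := by
    rcases eq_or_ne x 0 with rfl | hx
    · obtain rfl : y = 0 := by simpa using hyx
      simp [hq0.ne']
    have hr : 0 < ‖x‖ := norm_pos_iff.2 hx
    have hs := unit (‖x‖⁻¹ • x) (‖x‖⁻¹ • y) (by simp [norm_smul, hx]) (by
      rw [norm_smul_of_nonneg (by positivity), inv_mul_le_iff₀ hr, mul_one]
      exact hyx)
    rw [← smul_add, ← smul_sub] at hs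
    simp only [norm_smul_of_nonneg (inv_nonneg.2 hr.le), mul_div_assoc] at hs
    rw [Real.mul_rpow (by positivity) (by positivity), Real.mul_rpow (by positivity) (by positivity),
      Real.mul_rpow (by positivity) (by positivity),
      Real.mul_rpow (by positivity) (by positivity)] at hs
    have hrq : 0 < ‖x‖⁻¹ ^ q := by positivity
    refine le_of_mul_le_mul_left ?_ hrq
    linarith
  refine ⟨m / 2 ^ q, hc, fun x y => ?_⟩
  rcases le_total ‖y‖ ‖x‖ with hyx | hxy
  · exact ordered x y hyx
  · have := ordered y x hxy
    rwa [add_comm y x, norm_sub_rev y x, add_comm (‖y‖ ^ q)] at this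

/-- **Day's theorem**: the `ℓ^p` space of a uniformly convex space is uniformly convex for
`1 < p < ∞`. -/
theorem lp.uniformConvexSpace {ι : Type*} {p : ℝ≥0∞} [Fact (1 ≤ p)] (hp : 1 < p.toReal) :
    UniformConvexSpace (lp (fun _ : ι => E) p) where
  uniform_convex ε hε := by
    have hp0 : 0 < p.toReal := by linarith
    obtain ⟨c, hc, h⟩ := exists_norm_half_add_rpow_add_mul_norm_sub_rpow_le E hp
      (by positivity : 0 < ε ^ p.toReal / 4)
    set q := p.toReal
    have hd : 0 < c * ε ^ q / 2 := by positivity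
    have key (x y : lp (fun _ : ι => E) p) (hx : ‖x‖ = 1) (hy : ‖y‖ = 1) (hxy : ε ≤ ‖x - y‖) :
        (‖x + y‖ / 2) ^ q ≤ 1 - c * ε ^ q / 2 := by
      have hadd := (lp.hasSum_norm hp0 (x + y)).div_const (2 ^ q)
      have hsub := (lp.hasSum_norm hp0 (x - y)).mul_left c
      have hright := ((lp.hasSum_norm hp0 x).add (lp.hasSum_norm hp0 y)).mul_left
        (1 / 2 + c * (ε ^ q / 4))
      have hle := hasSum_le (fun i => by
        have := h (x i) (y i)
        rwa [Real.div_rpow (norm_nonneg _) zero_le_two] at this) (hadd.add hsub) hright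
      rw [← Real.div_rpow (norm_nonneg _) zero_le_two, hx, hy, Real.one_rpow] at hle
      have hεq : c * ε ^ q ≤ c * ‖x - y‖ ^ q := by gcongr
      linarith
    rcases lt_or_ge (1 - c * ε ^ q / 2) 0 with hneg | hnonneg
    · refine ⟨1, one_pos, fun x hx y hy hxy => absurd (key x y hx hy hxy) ?_⟩
      have : 0 ≤ (‖x + y‖ / 2) ^ q := by positivity
      linarith
    · have hlt : (1 - c * ε ^ q / 2) ^ q⁻¹ < 1 :=
        Real.rpow_lt_one hnonneg (by linarith) (inv_pos.2 hp0)
      refine ⟨2 - 2 * (1 - c * ε ^ q / 2) ^ q⁻¹, by linarith, fun x hx y hy hxy => ?_⟩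
      have := (Real.le_rpow_inv_iff_of_pos (by positivity) hnonneg hp0).2 (key x y hx hy hxy)
      linarith

end UniformConvex

/-- If `X` is a uniformly convex real Banach space and `1 < q < ∞` is a real number,
then the sequence space `ℓ^q(X)` is uniformly convex. -/
theorem lp_uniformConvex (X : Type*) [NormedAddCommGroup X] [NormedSpace ℝ X]
    [CompleteSpace X] [UniformConvexSpace X] (q : ℝ) (hq : 1 < q) :
    letI : Fact (1 ≤ ENNReal.ofReal q) := ⟨ENNReal.one_le_ofReal.mpr hq.le⟩
    UniformConvexSpace (lp (fun _ : ℕ => X) (ENNReal.ofReal q)) := by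
  have : Fact (1 ≤ ENNReal.ofReal q) := ⟨ENNReal.one_le_ofReal.mpr hq.le⟩
  exact lp.uniformConvexSpace X (by rwa [ENNReal.toReal_ofReal (by linarith)])
end

section
/- Let d ≥ 1 and let p be a real number with 1 < p < ∞. Let φ : ℝ^d → ℝ be a nonnegative, integrable, radially decreasing function (φ ≥ 0 and φ(y) ≤ φ(x) whenever |x| ≤ |y|) with ∫_{ℝ^d} φ(x) dx = 1, and for t > 0 set φ_t(x) = t^{−d} φ(x/t). Let (f_ν)_{ν∈ℕ} be a sequence of measurable functions on ℝ^d with Σ_ν ‖f_ν‖_{L^p(ℝ^d)} < ∞. Then for almost every x ∈ ℝ^d, Σ_ν ((φ_t * f_ν)(x) − f_ν(x))² → 0 as t → 0⁺; that is, the vector-valued mollification φ_t * (f_ν)_ν converges almost everywhere to (f_ν)_ν in the ℓ² sense. -/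
open MeasureTheory Filter Topology ENNReal

section RadialKernel

open Metric Module

variable {E : Type*} [NormedAddCommGroup E] [NormedSpace ℝ E] [FiniteDimensional ℝ E]
  [MeasurableSpace E] [BorelSpace E] {μ : Measure E} [μ.IsAddHaarMeasure]
  {φ : E → ℝ}

/-- The error of a mollification at a point is controlled by the mollified oscillation. -/
theorem enorm_integral_kernel_sub_le (hφ0 : ∀ x, 0 ≤ φ x) (hφint : Integrable φ μ)
    (hφ1 : ∫ x, φ x ∂μ = 1) {g : E → ℝ} (hg : AEStronglyMeasurable g μ) (x : E) {t : ℝ}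
    (ht : 0 < t) :
    ‖(∫ y, (t ^ finrank ℝ E)⁻¹ * φ (t⁻¹ • (x - y)) * g y ∂μ) - g x‖ₑ ≤
      ∫⁻ y, ENNReal.ofReal ((t ^ finrank ℝ E)⁻¹ * φ (t⁻¹ • (x - y))) * ‖g y - g x‖ₑ ∂μ := by
  set k : E → ℝ := fun y => (t ^ finrank ℝ E)⁻¹ * φ (t⁻¹ • (x - y)) with hk
  have hkint : Integrable k μ :=
    ((hφint.comp_smul (inv_ne_zero ht.ne')).comp_sub_left x).const_mul _
  have hk0 : ∀ y, 0 ≤ k y := fun y => mul_nonneg (by positivity) (hφ0 _)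
  have hk1 : ∫ y, k y ∂μ = 1 := by
    rw [hk, integral_const_mul, integral_sub_left_eq_self (fun z => φ (t⁻¹ • z)) μ x,
      Measure.integral_comp_smul, hφ1, inv_pow, inv_inv, abs_of_pos (by positivity), smul_eq_mul,
      mul_one, inv_mul_cancel₀ (by positivity)]
  have henorm : ∀ y, ‖k y * (g y - g x)‖ₑ = ENNReal.ofReal (k y) * ‖g y - g x‖ₑ := fun y => by
    rw [enorm_mul, Real.enorm_of_nonneg (hk0 y)]
  change _ ≤ ∫⁻ y, ENNReal.ofReal (k y) * ‖g y - g x‖ₑ ∂μ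
  rw [← lintegral_congr henorm]
  by_cases hfin : ∫⁻ y, ‖k y * (g y - g x)‖ₑ ∂μ = ∞
  · rw [hfin]; exact le_top
  have hint : Integrable (fun y => k y * (g y - g x)) μ :=
    ⟨hkint.1.mul (hg.sub aestronglyMeasurable_const), lt_top_iff_ne_top.2 hfin⟩
  have : (∫ y, k y * g y ∂μ) - g x = ∫ y, k y * (g y - g x) ∂μ := by
    have h2 : ∫ y, k y * g y ∂μ = ∫ y, (k y * (g y - g x) + k y * g x) ∂μ := by
      congr 1 with y
      ring
    rw [h2, integral_add hint (hkint.mul_const _), integral_mul_const, hk1, one_mul,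
      add_sub_cancel_right]
  rw [this]
  exact enorm_integral_le_lintegral_enorm _

variable [Nontrivial E]

/-- A superlevel set of finite measure of a radially decreasing function is a ball, up to a null
set. -/
theorem exists_superlevel_subset_closedBall (hφ : ∀ x y : E, ‖x‖ ≤ ‖y‖ → φ y ≤ φ x) {s : ℝ}
    (hs : μ {z | s < φ z} ≠ ∞) :
    ∃ R, 0 ≤ R ∧ {z | s < φ z} ⊆ closedBall 0 R ∧ μ (closedBall 0 R) ≤ μ {z | s < φ z} := by
  set S := {z | s < φ z}
  have hbdd : BddAbove (norm '' S) := by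
    by_contra hb
    refine hs ?_
    have hS_univ : S = Set.univ := by
      refine Set.eq_univ_of_forall fun z => ?_
      obtain ⟨_, ⟨y, hy, rfl⟩, hzy⟩ := not_bddAbove_iff.1 hb ‖z‖
      exact lt_of_lt_of_le hy (hφ z y hzy.le)
    have := NormedSpace.noncompactSpace ℝ E
    rw [hS_univ, measure_univ_of_isAddLeftInvariant]
  refine ⟨sSup (norm '' S), Real.sSup_nonneg ?_, fun z hz => ?_, ?_⟩
  · rintro _ ⟨y, -, rfl⟩
    exact norm_nonneg y
  · simpa using le_csSup hbdd ⟨z, hz, rfl⟩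
  · rw [Measure.addHaar_closedBall_eq_addHaar_ball]
    refine measure_mono fun z hz => ?_
    rcases S.eq_empty_or_nonempty with h | h
    · simp [h] at hz
    · obtain ⟨_, ⟨y, hy, rfl⟩, hzy⟩ := exists_lt_of_lt_csSup (h.image _) (by simpa using hz)
      exact lt_of_lt_of_le hy (hφ z y hzy.le)

/-- A radially decreasing approximate identity applied to a nonnegative function `h` tends to zero
at every point where the averages of `h` over balls are bounded and tend to zero. -/
theorem tendsto_lintegral_radial_kernel (hφ0 : ∀ x, 0 ≤ φ x) (hφint : Integrable φ μ)
    (hφ : ∀ x y : E, ‖x‖ ≤ ‖y‖ → φ y ≤ φ x) {h : E → ℝ≥0∞} (hh : AEMeasurable h μ) {x : E}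
    {M : ℝ≥0∞} (hM : M ≠ ∞)
    (hbound : ∀ r, 0 < r → ∫⁻ y in closedBall x r, h y ∂μ ≤ M * μ (closedBall x r))
    (hlim : Tendsto (fun r => (∫⁻ y in closedBall x r, h y ∂μ) / μ (closedBall x r))
      (𝓝[>] 0) (𝓝 0)) :
    Tendsto (fun t : ℝ => ∫⁻ y, ENNReal.ofReal ((t ^ finrank ℝ E)⁻¹ * φ (t⁻¹ • (x - y))) * h y ∂μ)
      (𝓝[>] 0) (𝓝 0) := by
  set m := μ.withDensity h with hm
  have hmac : m ≪ μ := withDensity_absolutelyContinuous μ h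
  have hball : ∀ r, m (closedBall x r) = ∫⁻ y in closedBall x r, h y ∂μ := fun r =>
    withDensity_apply _ measurableSet_closedBall
  set A : ℝ → ℝ≥0∞ := fun r => m (closedBall x r) / μ (closedBall x r) with hA
  have hAlim : Tendsto A (𝓝[≥] 0) (𝓝 0) := by
    have h0 : A 0 = 0 := by
      have : m {x} = 0 := hmac (by simp)
      simp [hA, this]
    rw [← Set.Ioi_insert, nhdsWithin_insert, tendsto_sup]
    refine ⟨?_, by simpa only [hA, hball] using hlim⟩
    rw [tendsto_pure_left]
    intro s hs
    rw [h0]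
    exact mem_of_mem_nhds hs
  have hmA : ∀ r, m (closedBall x r) ≤ A r * μ (closedBall x r) := fun r => by
    by_cases h0 : μ (closedBall x r) = 0
    · rw [hmac h0]; exact zero_le
    · rw [hA, ENNReal.div_mul_cancel h0 measure_closedBall_lt_top.ne]
  have hAM : ∀ r, 0 < r → A r ≤ M := fun r hr =>
    ENNReal.div_le_of_le_mul (by simpa only [hball] using hbound r hr)
  have hA0M : ∀ r, 0 ≤ r → A r ≤ M := fun r hr => by
    rcases hr.eq_or_lt with rfl | hr
    · have : m {x} = 0 := hmac (by simp)
      simp [hA, this]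
    · exact hAM r hr
  set V : ℝ → ℝ≥0∞ := fun s => μ {z | s < φ z} with hV
  have hVint : ∫⁻ s in Set.Ioi 0, V s ≠ ∞ := by
    rw [hV, ← lintegral_eq_lintegral_meas_lt μ (ae_of_all _ hφ0) hφint.aemeasurable]
    exact hφint.lintegral_lt_top.ne
  have hVfin : ∀ s, 0 < s → V s ≠ ∞ := fun s hs => (hφint.measure_gt_lt_top hs).ne
  have key : ∀ t, 0 < t → ∀ s R : ℝ, 0 ≤ R → {z | s < φ z} ⊆ closedBall 0 R →
      μ (closedBall 0 R) ≤ V s →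
      ENNReal.ofReal ((t ^ finrank ℝ E)⁻¹) * m {y | s < φ (t⁻¹ • (x - y))} ≤ A (t * R) * V s := by
    intro t ht s R hR hsub hle
    have htd : 0 < t ^ finrank ℝ E := by positivity
    have h1 : m {y | s < φ (t⁻¹ • (x - y))} ≤ m (closedBall x (t * R)) := by
      refine measure_mono fun y hy => ?_
      have := hsub hy
      rw [mem_closedBall_zero_iff, norm_smul, norm_inv, Real.norm_of_nonneg ht.le,
        inv_mul_le_iff₀ ht] at this
      rwa [mem_closedBall', dist_eq_norm]
    calc _ ≤ ENNReal.ofReal ((t ^ finrank ℝ E)⁻¹) * (A (t * R) *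
          (ENNReal.ofReal (t ^ finrank ℝ E) * μ (closedBall 0 R))) := by
          rw [← Measure.addHaar_closedBall_mul μ x ht.le hR]
          gcongr
          exact h1.trans (hmA _)
      _ = (ENNReal.ofReal ((t ^ finrank ℝ E)⁻¹) * ENNReal.ofReal (t ^ finrank ℝ E)) *
          (A (t * R) * μ (closedBall 0 R)) := by ring
      _ = A (t * R) * μ (closedBall 0 R) := by
          rw [← ENNReal.ofReal_mul (by positivity), inv_mul_cancel₀ htd.ne', ofReal_one, one_mul]
      _ ≤ _ := by gcongr
  have hrepr : ∀ t : ℝ, 0 < t →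
      ∫⁻ y, ENNReal.ofReal ((t ^ finrank ℝ E)⁻¹ * φ (t⁻¹ • (x - y))) * h y ∂μ =
      ∫⁻ s in Set.Ioi 0, ENNReal.ofReal ((t ^ finrank ℝ E)⁻¹) *
        m {y | s < φ (t⁻¹ • (x - y))} := by
    intro t ht
    have hmeas : AEMeasurable (fun y => φ (t⁻¹ • (x - y))) μ :=
      ((hφint.comp_smul (inv_ne_zero ht.ne')).comp_sub_left x).aemeasurable
    rw [lintegral_const_mul' _ _ ofReal_ne_top, ← lintegral_eq_lintegral_meas_lt m
      (ae_of_all _ fun y => hφ0 _) (hmeas.mono_ac hmac), ← lintegral_const_mul' _ _ ofReal_ne_top,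
      hm, lintegral_withDensity_eq_lintegral_mul₀ hh]
    · refine lintegral_congr fun y => ?_
      rw [Pi.mul_apply, ENNReal.ofReal_mul (by positivity), mul_comm]
    · exact (hmeas.ennreal_ofReal).const_mul _
  have hev : ∀ᶠ t : ℝ in 𝓝[>] 0, 0 < t := self_mem_nhdsWithin
  refine Tendsto.congr' (hev.mono fun t ht => (hrepr t ht).symm) ?_
  rw [show (0 : ℝ≥0∞) = ∫⁻ _ in Set.Ioi (0 : ℝ), 0 by simp]
  refine tendsto_lintegral_filter_of_dominated_convergence (fun s => M * V s) ?_ ?_ ?_ ?_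
  · refine .of_forall fun t => Measurable.const_mul (Antitone.measurable fun s s' hs => ?_) _
    exact measure_mono fun y hy => lt_of_le_of_lt hs hy
  · filter_upwards [hev] with t ht
    filter_upwards [ae_restrict_mem measurableSet_Ioi] with s hs
    obtain ⟨R, hR, hsub, hle⟩ := exists_superlevel_subset_closedBall hφ (hVfin s hs)
    refine (key t ht s R hR hsub hle).trans ?_
    gcongr
    exact hA0M _ (by positivity)
  · rw [lintegral_const_mul' _ _ hM]
    exact ENNReal.mul_ne_top hM hVint
  · filter_upwards [ae_restrict_mem measurableSet_Ioi] with s hs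
    obtain ⟨R, hR, hsub, hle⟩ := exists_superlevel_subset_closedBall hφ (hVfin s hs)
    have hR0 : Tendsto (fun t : ℝ => t * R) (𝓝[>] 0) (𝓝[≥] 0) := by
      refine tendsto_nhdsWithin_iff.2 ⟨?_, hev.mono fun t ht => Set.mem_Ici.2 (by positivity)⟩
      exact ((continuous_mul_const R).tendsto' 0 0 (zero_mul R)).mono_left nhdsWithin_le_nhds
    have := ENNReal.Tendsto.mul_const (hAlim.comp hR0) (.inr (hVfin s hs))
    rw [zero_mul] at this
    exact tendsto_of_tendsto_of_tendsto_of_le_of_le' tendsto_const_nhds this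
      (.of_forall fun _ => zero_le) (hev.mono fun t ht => key t ht s R hR hsub hle)

/-- Almost everywhere convergence of a radially decreasing approximate identity, for functions
whose integrals over balls grow at most like the volume. -/
theorem ae_tendsto_lintegral_radial_kernel_enorm_sub {F : Type*} [NormedAddCommGroup F]
    (hφ0 : ∀ x, 0 ≤ φ x) (hφint : Integrable φ μ) (hφ : ∀ x y : E, ‖x‖ ≤ ‖y‖ → φ y ≤ φ x)
    {f : E → F} (hf : AEStronglyMeasurable f μ) {C : ℝ≥0∞} (hC : C ≠ ∞)
    (hfC : ∀ x r, ∫⁻ y in closedBall x r, ‖f y‖ₑ ∂μ ≤ C * (1 + μ (closedBall x r))) :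
    ∀ᵐ x ∂μ, Tendsto (fun t : ℝ =>
      ∫⁻ y, ENNReal.ofReal ((t ^ finrank ℝ E)⁻¹ * φ (t⁻¹ • (x - y))) * ‖f y - f x‖ₑ ∂μ)
      (𝓝[>] 0) (𝓝 0) := by
  have hloc : LocallyIntegrable f μ := fun x =>
    ⟨closedBall x 1, closedBall_mem_nhds x one_pos, hf.restrict, (hfC x 1).trans_lt
      (ENNReal.mul_lt_top hC.lt_top (ENNReal.add_lt_top.2 ⟨one_lt_top, measure_closedBall_lt_top⟩))⟩
  filter_upwards [(Besicovitch.vitaliFamily μ).ae_tendsto_lintegral_enorm_sub_div hloc] with x hx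
  replace hx := hx.comp (Besicovitch.tendsto_filterAt μ x)
  obtain ⟨r₀, hr₀, hsmall⟩ : ∃ r₀ > 0, ∀ r, 0 < r → r < r₀ →
      (∫⁻ y in closedBall x r, ‖f y - f x‖ₑ ∂μ) / μ (closedBall x r) < 1 := by
    obtain ⟨r₀, hr₀, hsub⟩ := mem_nhdsGT_iff_exists_Ioo_subset.1 (hx.eventually_lt_const one_pos)
    exact ⟨r₀, hr₀, fun r h1 h2 => hsub ⟨h1, h2⟩⟩
  have hpos : ∀ r, 0 < r → μ (closedBall x r) ≠ 0 := fun r hr =>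
    (measure_closedBall_pos μ x hr).ne'
  refine tendsto_lintegral_radial_kernel (M := 1 + (C * ((μ (closedBall x r₀))⁻¹ + 1) + ‖f x‖ₑ))
    hφ0 hφint hφ (hf.sub aestronglyMeasurable_const).enorm ?_ ?_ hx
  · simp [ENNReal.mul_eq_top, hC, hpos r₀ hr₀]
  · intro r hr
    rcases lt_or_ge r r₀ with hlt | hle
    · have := (hsmall r hr hlt).le
      rw [ENNReal.div_le_iff (hpos r hr) measure_closedBall_lt_top.ne] at this
      refine this.trans ?_
      gcongr
      exact le_self_add
    · have h1 : 1 ≤ (μ (closedBall x r₀))⁻¹ * μ (closedBall x r) := by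
        rw [← ENNReal.inv_mul_cancel (hpos r₀ hr₀) measure_closedBall_lt_top.ne]
        gcongr
      calc ∫⁻ y in closedBall x r, ‖f y - f x‖ₑ ∂μ
          ≤ ∫⁻ y in closedBall x r, (‖f y‖ₑ + ‖f x‖ₑ) ∂μ := lintegral_mono fun y => enorm_sub_le
        _ = ∫⁻ y in closedBall x r, ‖f y‖ₑ ∂μ + ‖f x‖ₑ * μ (closedBall x r) := by
            rw [lintegral_add_right _ measurable_const, setLIntegral_const]
        _ ≤ C * ((μ (closedBall x r₀))⁻¹ * μ (closedBall x r) + μ (closedBall x r)) +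
            ‖f x‖ₑ * μ (closedBall x r) := by
            gcongr
            exact (hfC x r).trans (by gcongr)
        _ = (C * ((μ (closedBall x r₀))⁻¹ + 1) + ‖f x‖ₑ) * μ (closedBall x r) := by ring
        _ ≤ _ := mul_le_mul' le_add_self le_rfl

end RadialKernel

section SequenceValued

/-- A sequence of functions which is absolutely summable almost everywhere defines an
`ℓ¹`-valued function. -/
theorem exists_lp_one_valued {α : Type*} [MeasurableSpace α] {μ : Measure α} {f : ℕ → α → ℝ}
    (hf : ∀ n, Measurable (f n)) (hsum : ∀ᵐ x ∂μ, ∑' n, ‖f n x‖ₑ ≠ ∞) :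
    ∃ F : α → lp (fun _ : ℕ => ℝ) 1, AEStronglyMeasurable F μ ∧ ∀ᵐ x ∂μ, ∀ n, F x n = f n x := by
  classical
  have hmem : ∀ x, ∑' n, ‖f n x‖ₑ ≠ ∞ →
      Memℓp (E := fun _ : ℕ => ℝ) (fun n => f n x) 1 := fun x hx => by
    have hs : Summable fun n => f n x := Summable.of_enorm hx
    refine memℓp_gen ?_
    simpa using hs.abs
  let F : α → lp (fun _ : ℕ => ℝ) 1 := fun x =>
    if h : ∑' n, ‖f n x‖ₑ ≠ ∞ then ⟨fun n => f n x, hmem x h⟩ else 0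
  have hF : ∀ᵐ x ∂μ, ∀ n, F x n = f n x := by
    filter_upwards [hsum] with x hx n
    simp only [F, dif_pos hx]
  refine ⟨F, ?_, hF⟩
  refine aestronglyMeasurable_of_tendsto_ae atTop
    (f := fun N x => ∑ n ∈ Finset.range N, lp.single 1 n (f n x)) (fun N => ?_) ?_
  · refine Finset.aestronglyMeasurable_fun_sum _ fun n _ => ?_
    exact (lp.isometry_single n).continuous.comp_aestronglyMeasurable
      (hf n).aestronglyMeasurable
  · filter_upwards [hF] with x hx
    have := (lp.hasSum_single one_ne_top (F x)).tendsto_sum_nat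
    simpa only [hx] using this

theorem enorm_lp_one_eq_tsum (a : lp (fun _ : ℕ => ℝ) 1) : ‖a‖ₑ = ∑' n, ‖a n‖ₑ := by
  have hs : Summable fun n => ‖a n‖ := by
    simpa using (memℓp_gen_iff (p := 1) (by simp)).1 (lp.memℓp a)
  have h : ‖a‖ = ∑' n, ‖a n‖ := by
    simpa using lp.norm_eq_tsum_rpow (p := 1) (by simp) a
  simp_rw [← ofReal_norm]
  rw [h, ENNReal.ofReal_tsum_of_nonneg (fun _ => norm_nonneg _) hs]

/-- Hölder's inequality for the integral of a sum over a set. -/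
theorem setLIntegral_tsum_enorm_le {α : Type*} [MeasurableSpace α] {μ : Measure α} {p : ℝ}
    (hp : 1 ≤ p) {f : ℕ → α → ℝ} (hf : ∀ n, Measurable (f n)) (s : Set α) :
    ∫⁻ x in s, ∑' n, ‖f n x‖ₑ ∂μ ≤ (∑' n, eLpNorm (f n) (ENNReal.ofReal p) μ) * (1 + μ s) := by
  rw [lintegral_tsum fun n => (hf n).enorm.aemeasurable, ← ENNReal.tsum_mul_right]
  refine ENNReal.tsum_le_tsum fun n => ?_
  have h := eLpNorm_le_eLpNorm_mul_rpow_measure_univ (μ := μ.restrict s) (p := 1)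
    (q := ENNReal.ofReal p) (by simpa using hp) (hf n).aestronglyMeasurable
  rw [eLpNorm_one_eq_lintegral_enorm, Measure.restrict_apply_univ, toReal_one,
    ENNReal.toReal_ofReal (by linarith)] at h
  refine h.trans ?_
  gcongr
  · exact Measure.restrict_le_self
  · have h0 : 0 ≤ 1 / 1 - 1 / p := by
      rw [div_one, sub_nonneg, div_le_one (by linarith)]
      exact hp
    have h1 : 1 / 1 - 1 / p ≤ 1 := by
      have : 0 ≤ 1 / p := by positivity
      linarith
    calc μ s ^ (1 / 1 - 1 / p) ≤ (1 + μ s) ^ (1 / 1 - 1 / p) := by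
          gcongr
          exact le_add_self
      _ ≤ (1 + μ s) ^ (1 : ℝ) := ENNReal.rpow_le_rpow_of_exponent_le le_self_add h1
      _ = 1 + μ s := ENNReal.rpow_one _

theorem tsum_sq_le_sq_tsum (a : ℕ → ℝ≥0∞) : ∑' n, a n ^ 2 ≤ (∑' n, a n) ^ 2 := by
  rw [sq (∑' n, a n), ← ENNReal.tsum_mul_right]
  refine ENNReal.tsum_le_tsum fun n => ?_
  rw [sq]
  gcongr
  exact ENNReal.le_tsum n

end SequenceValued

/-- Potential-type approximate identity on `ℓ^1(L^p)`: if `φ ≥ 0` is integrable,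
radially decreasing, with `∫ φ = 1`, `φ_t(x) = t^{-d} φ(x/t)`, and `(f_ν)` are
measurable with `Σ_ν ‖f_ν‖_{L^p} < ∞` (`1 < p < ∞`), then for a.e. `x`,
`Σ_ν ((φ_t * f_ν)(x) - f_ν(x))² → 0` as `t → 0⁺`. -/
theorem approximate_identity_ae_tendsto (d : ℕ) (hd : 1 ≤ d) (p : ℝ) (hp : 1 < p)
    (φ : EuclideanSpace ℝ (Fin d) → ℝ)
    (hφ0 : ∀ x, 0 ≤ φ x) (hφint : Integrable φ)
    (hφrad : ∀ x y : EuclideanSpace ℝ (Fin d), ‖x‖ ≤ ‖y‖ → φ y ≤ φ x)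
    (hφ1 : ∫ x, φ x = 1)
    (f : ℕ → EuclideanSpace ℝ (Fin d) → ℝ) (hf : ∀ ν, Measurable (f ν))
    (hsum : ∑' ν, eLpNorm (f ν) (ENNReal.ofReal p) volume < ⊤) :
    ∀ᵐ x ∂(volume : Measure (EuclideanSpace ℝ (Fin d))),
      Tendsto
        (fun t : ℝ => ∑' ν, ENNReal.ofReal
          (((∫ y, (t ^ d)⁻¹ * φ (t⁻¹ • (x - y)) * f ν y) - f ν x) ^ 2))
        (𝓝[>] 0) (𝓝 0) := by
  have : Nonempty (Fin d) := ⟨⟨0, hd⟩⟩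
  set C := ∑' ν, eLpNorm (f ν) (ENNReal.ofReal p) volume
  have hfC := setLIntegral_tsum_enorm_le (μ := (volume : Measure (EuclideanSpace ℝ (Fin d))))
    hp.le hf
  have hsum_ae : ∀ᵐ x : EuclideanSpace ℝ (Fin d), ∑' ν, ‖f ν x‖ₑ ≠ ∞ := by
    have hball : ∀ n : ℕ, ∀ᵐ x : EuclideanSpace ℝ (Fin d), x ∈ Metric.closedBall 0 (n : ℝ) →
        ∑' ν, ‖f ν x‖ₑ < ∞ := fun n => by
      rw [← ae_restrict_iff' measurableSet_closedBall]
      refine ae_lt_top (Measurable.tsum fun ν => (hf ν).enorm) ((hfC _).trans_lt ?_).ne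
      exact ENNReal.mul_lt_top hsum (ENNReal.add_lt_top.2 ⟨one_lt_top, measure_closedBall_lt_top⟩)
    filter_upwards [ae_all_iff.2 hball] with x hx
    obtain ⟨n, hn⟩ := exists_nat_ge ‖x‖
    exact (hx n (by simpa using hn)).ne
  obtain ⟨F, hFm, hF⟩ := exists_lp_one_valued hf hsum_ae
  have hFC : ∀ x r, ∫⁻ y in Metric.closedBall x r, ‖F y‖ₑ ≤
      C * (1 + volume (Metric.closedBall x r)) := fun x r => by
    refine le_of_eq_of_le (lintegral_congr_ae ?_) (hfC _)
    filter_upwards [ae_restrict_of_ae hF] with y hy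
    simp only [enorm_lp_one_eq_tsum, hy]
  filter_upwards [ae_tendsto_lintegral_radial_kernel_enorm_sub hφ0 hφint hφrad hFm hsum.ne hFC, hF]
    with x hx hFx
  have hsq := ENNReal.Tendsto.pow (n := 2) hx
  rw [zero_pow two_ne_zero] at hsq
  refine tendsto_of_tendsto_of_tendsto_of_le_of_le' tendsto_const_nhds hsq
    (.of_forall fun _ => zero_le) ?_
  filter_upwards [self_mem_nhdsWithin] with t ht
  have hmeas : AEMeasurable fun y => ENNReal.ofReal
      ((t ^ Module.finrank ℝ (EuclideanSpace ℝ (Fin d)))⁻¹ * φ (t⁻¹ • (x - y))) :=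
    ((hφint.comp_smul (inv_ne_zero (ne_of_gt ht))).comp_sub_left
      x).aemeasurable.const_mul _ |>.ennreal_ofReal
  calc _ = ∑' ν, ‖(∫ y, (t ^ d)⁻¹ * φ (t⁻¹ • (x - y)) * f ν y) - f ν x‖ₑ ^ 2 := by
        refine tsum_congr fun ν => ?_
        rw [← sq_abs, ENNReal.ofReal_pow (abs_nonneg _), ← Real.norm_eq_abs, ofReal_norm]
    _ ≤ (∑' ν, ‖(∫ y, (t ^ d)⁻¹ * φ (t⁻¹ • (x - y)) * f ν y) - f ν x‖ₑ) ^ 2 :=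
        tsum_sq_le_sq_tsum _
    _ ≤ _ := by
        gcongr
        calc _ ≤ ∑' ν, ∫⁻ y, ENNReal.ofReal
              ((t ^ Module.finrank ℝ (EuclideanSpace ℝ (Fin d)))⁻¹ * φ (t⁻¹ • (x - y))) *
              ‖f ν y - f ν x‖ₑ := by
              refine ENNReal.tsum_le_tsum fun ν => ?_
              have := enorm_integral_kernel_sub_le hφ0 hφint hφ1
                (hf ν).aestronglyMeasurable x ht
              simpa only [finrank_euclideanSpace_fin] using this
          _ = _ := by
              rw [← lintegral_tsum fun ν =>
                hmeas.fun_mul ((hf ν).sub_const (f ν x)).enorm.aemeasurable]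
              refine lintegral_congr_ae ?_
              filter_upwards [hF] with y hy
              rw [ENNReal.tsum_mul_left, enorm_lp_one_eq_tsum]
              simp [hy, hFx]
end
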